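/- arXiv:0904.3877 — 4 statements merged into one kernel-verified Lean document; each statement's English description precedes it below -/
import Mathlib

section
/- Let 𝒟 ⊆ ℂ be a bounded domain (nonempty connected open set). A map F : 𝒟 × ℂ → 𝒟 × ℂ is an automorphism of 𝒟 × ℂ if and only if there exist an automorphism a of 𝒟, a holomorphic function b : 𝒟 → ℂ*, and a holomorphic function c : 𝒟 → ℂ such that F(λ, z) = (a(λ), b(λ)·z + c(λ)) for all (λ,z) ∈ 𝒟 × ℂ. -/
open Complex Set

noncomputable section

/-- `F` is an automorphism of the domain `D ⊆ ℂ²`. -/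
def IsAutomorphismOn (D : Set (ℂ × ℂ)) (F : ℂ × ℂ → ℂ × ℂ) : Prop :=
  DifferentiableOn ℂ F D ∧ Set.BijOn F D D ∧
    ∃ G : ℂ × ℂ → ℂ × ℂ, DifferentiableOn ℂ G D ∧
      (∀ z ∈ D, G (F z) = z) ∧ (∀ z ∈ D, F (G z) = z)

/-- `a` is an automorphism of the domain `𝒟 ⊆ ℂ`. -/
def IsAutomorphismOn1 (𝒟 : Set ℂ) (a : ℂ → ℂ) : Prop :=
  DifferentiableOn ℂ a 𝒟 ∧ Set.BijOn a 𝒟 𝒟 ∧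
    ∃ g : ℂ → ℂ, DifferentiableOn ℂ g 𝒟 ∧
      (∀ z ∈ 𝒟, g (a z) = z) ∧ (∀ z ∈ 𝒟, a (g z) = z)

/-- An entire function with an entire two-sided inverse is affine. -/
theorem entire_automorphism_affine {f g : ℂ → ℂ} (hf : Differentiable ℂ f)
    (hg : Differentiable ℂ g) (hgf : ∀ z, g (f z) = z) (hfg : ∀ z, f (g z) = z) (z : ℂ) :
    f z = (f 1 - f 0) * z + f 0 := by
  have hinj : Function.Injective f := Function.LeftInverse.injective hgf
  have hderiv : deriv f 0 ≠ 0 := by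
    intro h
    have hcomp : HasDerivAt (g ∘ f) (deriv g (f 0) * deriv f 0) 0 :=
      (hg (f 0)).hasDerivAt.comp 0 (hf 0).hasDerivAt
    have hid : g ∘ f = id := funext hgf
    rw [hid, h, mul_zero] at hcomp
    exact zero_ne_one (hcomp.unique (hasDerivAt_id 0))
  have hdslope : ∀ u : ℂ → ℂ, Differentiable ℂ u → Differentiable ℂ (dslope u 0) := by
    intro u hu
    rw [← differentiableOn_univ] at hu ⊢
    exact (Complex.differentiableOn_dslope Filter.univ_mem).2 hu
  have hne : ∀ w, dslope f 0 w ≠ 0 := by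
    intro w
    rcases eq_or_ne w 0 with rfl | hw
    · simpa using hderiv
    · rw [dslope_of_ne _ hw, slope_def_field]
      exact div_ne_zero (sub_ne_zero.2 (hinj.ne hw)) (by simpa using hw)
  set p : ℂ → ℂ := fun w => (dslope f 0 w)⁻¹ with hp
  have hpd : Differentiable ℂ p := (hdslope f hf).inv hne
  have hcoc : Filter.Tendsto f (Filter.cocompact ℂ) (Filter.cocompact ℂ) :=
    (Homeomorph.mk ⟨f, g, hgf, hfg⟩ hf.continuous hg.continuous).isClosedEmbedding.tendsto_cocompact
  have hinv : Filter.Tendsto (fun w : ℂ => w⁻¹) (Filter.cocompact ℂ) (nhds 0) :=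
    Filter.tendsto_inv₀_cobounded.mono_left (Metric.cobounded_eq_cocompact (α := ℂ)).ge
  have hsub : Filter.Tendsto (fun w => (f w - f 0)⁻¹) (Filter.cocompact ℂ) (nhds 0) :=
    hinv.comp ((Homeomorph.subRight (f 0)).isClosedEmbedding.tendsto_cocompact.comp hcoc)
  have hlim : Filter.Tendsto (dslope p 0) (Filter.cocompact ℂ) (nhds 0) := by
    have h := hsub.sub (hinv.const_mul (p 0))
    rw [mul_zero, sub_zero] at h
    refine h.congr' ?_
    have hev : ∀ᶠ w : ℂ in Filter.cocompact ℂ, w ≠ 0 :=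
      (isCompact_singleton (x := (0 : ℂ))).compl_mem_cocompact
    filter_upwards [hev] with w hw
    have hfw : f w - f 0 ≠ 0 := sub_ne_zero.2 (hinj.ne hw)
    have hpw : p w = w / (f w - f 0) := by
      simp [hp, dslope_of_ne _ hw, slope_def_field]
    rw [dslope_of_ne _ hw, slope_def_field, hpw]
    field_simp
    ring
  have hzero : ∀ w, dslope p 0 w = 0 := fun w =>
    (hdslope p hpd).apply_eq_of_tendsto_cocompact w hlim
  have hconst : ∀ w, dslope f 0 w = dslope f 0 0 := by
    intro w
    have h := sub_smul_dslope p 0 w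
    rw [hzero, smul_zero] at h
    exact inv_injective (sub_eq_zero.1 h.symm)
  have haff : ∀ w, f w - f 0 = w * dslope f 0 0 := by
    intro w
    simpa only [hconst w, sub_zero, smul_eq_mul] using (sub_smul_dslope f 0 w).symm
  linear_combination haff z - z * haff 1

/-- A holomorphic map from `𝒟 × ℂ` to a cylinder over a bounded set has first component
independent of the second variable. -/
theorem fst_eq_of_mapsTo_bounded {𝒟 : Set ℂ} (hopen : IsOpen 𝒟)
    (hbdd : Bornology.IsBounded 𝒟) {F : ℂ × ℂ → ℂ × ℂ}
    (hF : DifferentiableOn ℂ F (𝒟 ×ˢ (univ : Set ℂ)))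
    (hmaps : MapsTo F (𝒟 ×ˢ (univ : Set ℂ)) (𝒟 ×ˢ (univ : Set ℂ)))
    {l : ℂ} (hl : l ∈ 𝒟) (z w : ℂ) : (F (l, z)).1 = (F (l, w)).1 := by
  have hd : Differentiable ℂ fun z => (F (l, z)).1 := fun z =>
    ((hF.differentiableAt ((hopen.prod isOpen_univ).mem_nhds ⟨hl, mem_univ z⟩)).comp z
      (by fun_prop : DifferentiableAt ℂ (fun z => (l, z)) z)).fst
  refine hd.apply_eq_apply_of_bounded (hbdd.subset ?_) z w
  rintro _ ⟨z, rfl⟩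
  exact (hmaps (⟨hl, mem_univ z⟩ : (l, z) ∈ 𝒟 ×ˢ (univ : Set ℂ))).1

/-- A left inverse on `s` of a surjective map of `s` maps `s` to itself. -/
theorem mapsTo_of_leftInv_of_surjOn {α : Type*} {s : Set α} {f g : α → α}
    (hsurj : SurjOn f s s) (hgf : ∀ x ∈ s, g (f x) = x) : MapsTo g s s := by
  intro x hx
  obtain ⟨y, hy, rfl⟩ := hsurj hx
  rwa [hgf y hy]

/-- For a bounded domain `𝒟 ⊆ ℂ`, the automorphisms of `𝒟 × ℂ` are exactly the
maps `(λ, z) ↦ (a(λ), b(λ) z + c(λ))` with `a ∈ Aut(𝒟)`, `b : 𝒟 → ℂ*` and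
`c : 𝒟 → ℂ` holomorphic. -/
theorem aut_bounded_times_C
    (𝒟 : Set ℂ) (hopen : IsOpen 𝒟) (hconn : IsConnected 𝒟)
    (hbdd : Bornology.IsBounded 𝒟) (F : ℂ × ℂ → ℂ × ℂ) :
    IsAutomorphismOn (𝒟 ×ˢ (Set.univ : Set ℂ)) F ↔
      ∃ a : ℂ → ℂ, IsAutomorphismOn1 𝒟 a ∧
        ∃ b c : ℂ → ℂ, DifferentiableOn ℂ b 𝒟 ∧ (∀ l ∈ 𝒟, b l ≠ 0) ∧
          DifferentiableOn ℂ c 𝒟 ∧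
          ∀ z ∈ 𝒟 ×ˢ (Set.univ : Set ℂ), F z = (a z.1, b z.1 * z.2 + c z.1) := by
  constructor
  · rintro ⟨hF, hbij, G, hG, hGF, hFG⟩
    have hmF := hbij.mapsTo
    have hmG := mapsTo_of_leftInv_of_surjOn hbij.surjOn hGF
    have hmem : ∀ {l : ℂ}, l ∈ 𝒟 → ∀ z : ℂ, (l, z) ∈ 𝒟 ×ˢ (univ : Set ℂ) :=
      fun hl z => ⟨hl, mem_univ z⟩
    have hF1 : ∀ {l : ℂ}, l ∈ 𝒟 → ∀ z, (F (l, z)).1 = (F (l, 0)).1 :=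
      fun hl z => fst_eq_of_mapsTo_bounded hopen hbdd hF hmF hl z 0
    have hG1 : ∀ {l : ℂ}, l ∈ 𝒟 → ∀ z, (G (l, z)).1 = (G (l, 0)).1 :=
      fun hl z => fst_eq_of_mapsTo_bounded hopen hbdd hG hmG hl z 0
    have hslice : ∀ {H : ℂ × ℂ → ℂ × ℂ}, DifferentiableOn ℂ H (𝒟 ×ˢ (univ : Set ℂ)) →
        ∀ z : ℂ, DifferentiableOn ℂ (fun l => H (l, z)) 𝒟 := fun hH z =>
      hH.comp (by fun_prop : DifferentiableOn ℂ (fun l : ℂ => (l, z)) 𝒟) fun l hl => hmem hl z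
    have hfiber : ∀ {H : ℂ × ℂ → ℂ × ℂ}, DifferentiableOn ℂ H (𝒟 ×ˢ (univ : Set ℂ)) →
        ∀ {l : ℂ}, l ∈ 𝒟 → Differentiable ℂ fun z => (H (l, z)).2 := fun hH l hl z =>
      ((hH.differentiableAt ((hopen.prod isOpen_univ).mem_nhds (hmem hl z))).comp z
        (by fun_prop : DifferentiableAt ℂ (fun z => (l, z)) z)).snd
    have hga : ∀ l ∈ 𝒟, (G ((F (l, 0)).1, 0)).1 = l := by
      intro l hl
      rw [← hG1 (hmF (hmem hl 0)).1 (F (l, 0)).2, Prod.mk.eta, hGF _ (hmem hl 0)]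
    have hag : ∀ l ∈ 𝒟, (F ((G (l, 0)).1, 0)).1 = l := by
      intro l hl
      rw [← hF1 (hmG (hmem hl 0)).1 (G (l, 0)).2, Prod.mk.eta, hFG _ (hmem hl 0)]
    refine ⟨fun l => (F (l, 0)).1, ⟨(hslice hF 0).fst, ?_, fun l => (G (l, 0)).1,
      (hslice hG 0).fst, hga, hag⟩, fun l => (F (l, 1)).2 - (F (l, 0)).2,
      fun l => (F (l, 0)).2, (hslice hF 1).snd.sub (hslice hF 0).snd, ?_,
      (hslice hF 0).snd, ?_⟩
    · exact InvOn.bijOn (f' := fun l => (G (l, 0)).1) ⟨hga, hag⟩ (fun l hl => (hmF (hmem hl 0)).1)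
        (fun l hl => (hmG (hmem hl 0)).1)
    · intro l hl h
      have heq : F (l, 1) = F (l, 0) := Prod.ext (hF1 hl 1) (sub_eq_zero.1 h)
      exact one_ne_zero (congrArg Prod.snd (hbij.injOn (hmem hl 1) (hmem hl 0) heq))
    · rintro ⟨l, z⟩ ⟨hl, -⟩
      have hal : (F (l, 0)).1 ∈ 𝒟 := (hmF (hmem hl 0)).1
      refine Prod.ext (hF1 hl z) (entire_automorphism_affine (hfiber hF hl)
        (hfiber hG hal) (fun w => ?_) (fun w => ?_) z)
      · rw [← hF1 hl w, Prod.mk.eta, hGF _ (hmem hl w)]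
      · have hfst : (G ((F (l, 0)).1, w)).1 = l := (hG1 hal w).trans (hga l hl)
        have h := hFG _ (hmem hal w)
        rw [← Prod.mk.eta (p := G ((F (l, 0)).1, w)), hfst] at h
        exact congrArg Prod.snd h
  · rintro ⟨a, ⟨ha, habij, g, hg, hga, hag⟩, b, c, hb, hb0, hc, hF⟩
    have hmg := mapsTo_of_leftInv_of_surjOn habij.surjOn hga
    have hfst : MapsTo Prod.fst (𝒟 ×ˢ (univ : Set ℂ)) 𝒟 := fun _ hz => hz.1
    have hlift : ∀ {u : ℂ → ℂ}, DifferentiableOn ℂ u 𝒟 →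
        DifferentiableOn ℂ (fun z : ℂ × ℂ => u z.1) (𝒟 ×ˢ (univ : Set ℂ)) :=
      fun hu => hu.comp differentiableOn_fst hfst
    set G : ℂ × ℂ → ℂ × ℂ := fun w => (g w.1, (w.2 - c (g w.1)) / b (g w.1)) with hGdef
    have hmF : MapsTo F (𝒟 ×ˢ (univ : Set ℂ)) (𝒟 ×ˢ (univ : Set ℂ)) := fun z hz => by
      rw [hF z hz]
      exact ⟨habij.mapsTo hz.1, mem_univ _⟩
    have hmG : MapsTo G (𝒟 ×ˢ (univ : Set ℂ)) (𝒟 ×ˢ (univ : Set ℂ)) :=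
      fun z hz => ⟨hmg hz.1, mem_univ _⟩
    have hGF : ∀ z ∈ 𝒟 ×ˢ (univ : Set ℂ), G (F z) = z := by
      intro z hz
      have := hb0 z.1 hz.1
      rw [hF z hz]
      ext <;> simp [hGdef, hga z.1 hz.1, this]
    have hFG : ∀ z ∈ 𝒟 ×ˢ (univ : Set ℂ), F (G z) = z := by
      intro z hz
      have := hb0 _ (hmg hz.1)
      rw [hF _ (hmG hz)]
      ext
      · simp [hGdef, hag z.1 hz.1]
      · simp [hGdef, mul_div_cancel₀ _ this]
    refine ⟨?_, InvOn.bijOn ⟨hGF, hFG⟩ hmF hmG, G, ?_, hGF, hFG⟩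
    · exact ((hlift ha).prodMk (((hlift hb).mul differentiableOn_snd).add (hlift hc))).congr hF
    · have hinv : DifferentiableOn ℂ (fun l => (b (g l))⁻¹) 𝒟 :=
        (hb.comp hg hmg).inv fun l hl => hb0 _ (hmg hl)
      simp only [hGdef, div_eq_mul_inv]
      exact (hlift hg).prodMk
        ((differentiableOn_snd.sub (hlift (hc.comp hg hmg))).mul (hlift hinv))
end
end

section
/- Let 𝒟 ⊆ ℂ be a bounded domain (nonempty connected open set). A map F : 𝒟 × ℂ* → 𝒟 × ℂ* is an automorphism of 𝒟 × ℂ* if and only if there exist an automorphism a of 𝒟, a holomorphic function b : 𝒟 → ℂ*, and ε ∈ {1, −1} such that F(λ, z) = (a(λ), b(λ)·z^ε) for all (λ,z) ∈ 𝒟 × ℂ*. -/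
open Complex Set

noncomputable section

open Filter Topology

/-- `f` and `g` are mutually inverse automorphisms of the punctured plane `ℂ*`. -/
structure IsPuncturedPlaneAut (f g : ℂ → ℂ) : Prop where
  differentiableOn : DifferentiableOn ℂ f {z | z ≠ 0}
  differentiableOn_symm : DifferentiableOn ℂ g {z | z ≠ 0}
  map_ne_zero : ∀ z, z ≠ 0 → f z ≠ 0
  symm_ne_zero : ∀ z, z ≠ 0 → g z ≠ 0
  left_inv : ∀ z, z ≠ 0 → g (f z) = z
  right_inv : ∀ z, z ≠ 0 → f (g z) = z

lemma isOpen_setOf_ne_zero : IsOpen {z : ℂ | z ≠ 0} := isOpen_ne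

/-- A holomorphic function on `ℂ*` with a limit at `0` extends to an entire function. -/
lemma differentiable_update_of_tendsto {f : ℂ → ℂ} {c : ℂ}
    (hf : DifferentiableOn ℂ f {z | z ≠ 0}) (hc : Tendsto f (𝓝[≠] 0) (𝓝 c)) :
    Differentiable ℂ (Function.update f 0 c) := by
  rw [← differentiableOn_univ,
    ← differentiableOn_compl_singleton_and_continuousAt_iff (c := 0) univ_mem]
  refine ⟨fun z hz => ?_, continuousAt_update_same.2 hc⟩
  have hz0 : z ≠ 0 := hz.2
  refine DifferentiableAt.differentiableWithinAt ?_
  refine (hf.differentiableAt (isOpen_setOf_ne_zero.mem_nhds hz0)).congr_of_eventuallyEq ?_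
  filter_upwards [isOpen_setOf_ne_zero.mem_nhds hz0] with w hw
  exact Function.update_of_ne hw _ _

/-- A holomorphic function on `ℂ*` with finite limits at `0` and at `∞` is constant. -/
lemma eq_const_of_tendsto_zero_of_tendsto_inv {f : ℂ → ℂ} {c d : ℂ}
    (hf : DifferentiableOn ℂ f {z | z ≠ 0}) (hc : Tendsto f (𝓝[≠] 0) (𝓝 c))
    (hd : Tendsto (fun z => f z⁻¹) (𝓝[≠] 0) (𝓝 d)) {z : ℂ} (hz : z ≠ 0) : f z = d := by
  have hlim : Tendsto (Function.update f 0 c) (cocompact ℂ) (𝓝 d) := by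
    rw [← Metric.cobounded_eq_cocompact]
    refine (hd.comp tendsto_inv₀_cobounded').congr' ?_
    filter_upwards [Bornology.eventually_ne_cobounded (0 : ℂ)] with w hw
    simp [Function.update_of_ne hw]
  simpa [Function.update_of_ne hz] using
    (differentiable_update_of_tendsto hf hc).apply_eq_of_tendsto_cocompact z hlim

/-- A bounded holomorphic function on `ℂ*` is constant. -/
lemma apply_eq_apply_one_of_isBounded {f : ℂ → ℂ} (hf : DifferentiableOn ℂ f {z | z ≠ 0})
    (hb : Bornology.IsBounded (f '' {z | z ≠ 0})) {z : ℂ} (hz : z ≠ 0) : f z = f 1 := by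
  have hd : Differentiable ℂ (fun w => f (exp w)) := fun w =>
    (hf.differentiableAt (isOpen_setOf_ne_zero.mem_nhds (exp_ne_zero w))).comp w
      differentiable_exp.differentiableAt
  have h := hd.apply_eq_apply_of_bounded
    (hb.subset (range_subset_iff.2 fun w => mem_image_of_mem f (exp_ne_zero w))) (log z) 0
  simpa [exp_log hz] using h

namespace IsPuncturedPlaneAut

variable {f g : ℂ → ℂ}

lemma symm (h : IsPuncturedPlaneAut f g) : IsPuncturedPlaneAut g f :=
  ⟨h.differentiableOn_symm, h.differentiableOn, h.symm_ne_zero, h.map_ne_zero, h.right_inv,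
    h.left_inv⟩

lemma differentiableAt (h : IsPuncturedPlaneAut f g) {z : ℂ} (hz : z ≠ 0) :
    DifferentiableAt ℂ f z :=
  h.differentiableOn.differentiableAt (isOpen_setOf_ne_zero.mem_nhds hz)

lemma inv_comp (h : IsPuncturedPlaneAut f g) :
    IsPuncturedPlaneAut (fun z => (f z)⁻¹) (fun z => g z⁻¹) where
  differentiableOn := h.differentiableOn.inv h.map_ne_zero
  differentiableOn_symm := h.differentiableOn_symm.comp
    (differentiableOn_inv.mono fun _ hz => hz) fun _ hz => inv_ne_zero hz
  map_ne_zero z hz := inv_ne_zero (h.map_ne_zero z hz)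
  symm_ne_zero z hz := h.symm_ne_zero _ (inv_ne_zero hz)
  left_inv z hz := by simp [h.left_inv z hz]
  right_inv z hz := by simp [h.right_inv z⁻¹ (inv_ne_zero hz)]

lemma comp_inv (h : IsPuncturedPlaneAut f g) :
    IsPuncturedPlaneAut (fun z => f z⁻¹) (fun z => (g z)⁻¹) :=
  h.symm.inv_comp.symm

/-- An automorphism of `ℂ*` stays away from some nonzero value near the origin. -/
lemma exists_le_norm_sub (h : IsPuncturedPlaneAut f g) :
    ∃ w : ℂ, w ≠ 0 ∧ ∃ δ > 0, ∀ z, z ≠ 0 → ‖z‖ < 1 → δ ≤ ‖f z - w‖ := by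
  have hw : f 2 ≠ 0 := h.map_ne_zero 2 two_ne_zero
  have hcont : ContinuousAt g (f 2) := (h.symm.differentiableAt hw).continuousAt
  have hball : Metric.ball (2 : ℂ) 1 ∈ 𝓝 (g (f 2)) := by
    rw [h.left_inv 2 two_ne_zero]
    exact Metric.ball_mem_nhds _ one_pos
  obtain ⟨δ, hδ, hsub⟩ := Metric.mem_nhds_iff.1 (hcont hball)
  refine ⟨f 2, hw, δ, hδ, fun z hz hz1 => not_lt.1 fun hlt => ?_⟩
  have hmem : g (f z) ∈ Metric.ball (2 : ℂ) 1 :=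
    hsub (by rwa [Metric.mem_ball, dist_eq_norm])
  rw [h.left_inv z hz, Metric.mem_ball, dist_eq_norm] at hmem
  have htri : ‖(2 : ℂ)‖ ≤ ‖z‖ + ‖z - 2‖ := by
    have := norm_sub_le z (z - 2)
    simpa using this
  rw [Complex.norm_ofNat] at htri
  linarith

/-- An automorphism of `ℂ*` tends to `0` or to `∞` at the origin. -/
lemma tendsto_zero_or_inv_tendsto_zero (h : IsPuncturedPlaneAut f g) :
    Tendsto f (𝓝[≠] 0) (𝓝 0) ∨ Tendsto (fun z => (f z)⁻¹) (𝓝[≠] 0) (𝓝 0) := by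
  obtain ⟨w, hw, δ, hδ, hle⟩ := h.exists_le_norm_sub
  set φ : ℂ → ℂ := fun z => (f z - w)⁻¹ with hφ
  have hmem : ∀ᶠ z : ℂ in 𝓝[≠] 0, z ≠ 0 ∧ ‖z‖ < 1 := by
    filter_upwards [self_mem_nhdsWithin,
      mem_nhdsWithin_of_mem_nhds (Metric.ball_mem_nhds (0 : ℂ) one_pos)] with z hz hz1
    exact ⟨hz, by simpa using hz1⟩
  have hne : ∀ᶠ z : ℂ in 𝓝[≠] 0, f z - w ≠ 0 := by
    filter_upwards [hmem] with z hz
    exact norm_pos_iff.1 (hδ.trans_le (hle z hz.1 hz.2))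
  have hlim : Tendsto φ (𝓝[≠] 0) (𝓝 (limUnder (𝓝[≠] 0) φ)) := by
    refine tendsto_limUnder_of_differentiable_on_punctured_nhds_of_bounded_under ?_ ?_
    · filter_upwards [hmem, hne] with z hz hzne
      exact ((h.differentiableAt hz.1).sub_const w).inv hzne
    · refine isBoundedUnder_of_eventually_le (a := δ⁻¹ + ‖φ 0‖) ?_
      filter_upwards [hmem] with z hz
      refine (norm_sub_le _ _).trans (add_le_add_left ?_ _)
      rw [hφ, norm_inv]
      exact inv_anti₀ hδ (hle z hz.1 hz.2)
  generalize limUnder (𝓝[≠] 0) φ = L at hlim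
  rcases eq_or_ne L 0 with rfl | hL
  · right
    have hlim' : Tendsto (fun z => φ z / (w * φ z + 1)) (𝓝[≠] 0) (𝓝 (0 / (w * 0 + 1))) :=
      hlim.div ((hlim.const_mul w).add_const 1) (by simp)
    rw [zero_div] at hlim'
    refine hlim'.congr' ?_
    filter_upwards [hne, hmem] with z hz hz0
    have := h.map_ne_zero z hz0.1
    simp only [hφ]
    field_simp
    simpa using this
  · left
    have hf : Tendsto f (𝓝[≠] 0) (𝓝 (w + L⁻¹)) :=
      ((hlim.inv₀ hL).const_add w).congr fun z => by simp [hφ]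
    generalize w + L⁻¹ = c at hf
    rcases eq_or_ne c 0 with rfl | hc
    · exact hf
    · have hg : Tendsto (fun z => g (f z)) (𝓝[≠] 0) (𝓝 (g c)) :=
        (h.symm.differentiableAt hc).continuousAt.tendsto.comp hf
      have hid : Tendsto (fun z => g (f z)) (𝓝[≠] 0) (𝓝 0) := by
        refine (tendsto_id.mono_left nhdsWithin_le_nhds).congr' ?_
        filter_upwards [self_mem_nhdsWithin] with z hz
        exact (h.left_inv z hz).symm
      exact absurd (tendsto_nhds_unique hg hid) (h.symm_ne_zero c hc)

lemma tendsto_nhdsNE (h : IsPuncturedPlaneAut f g) (hf : Tendsto f (𝓝[≠] 0) (𝓝 0)) :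
    Tendsto f (𝓝[≠] 0) (𝓝[≠] 0) := by
  refine tendsto_nhdsWithin_iff.2 ⟨hf, ?_⟩
  filter_upwards [self_mem_nhdsWithin] with z hz
  exact h.map_ne_zero z hz

/-- If an automorphism of `ℂ*` tends to `0` at the origin, so does its inverse. -/
lemma symm_tendsto_zero (h : IsPuncturedPlaneAut f g) (hf : Tendsto f (𝓝[≠] 0) (𝓝 0)) :
    Tendsto g (𝓝[≠] 0) (𝓝 0) := by
  refine h.symm.tendsto_zero_or_inv_tendsto_zero.resolve_right fun hg => ?_
  have hinv : Tendsto (fun z : ℂ => z⁻¹) (𝓝[≠] 0) (𝓝 0) := by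
    refine (hg.comp (h.tendsto_nhdsNE hf)).congr' ?_
    filter_upwards [self_mem_nhdsWithin] with z hz
    simp [h.left_inv z hz]
  exact (not_tendsto_nhds_of_tendsto_atTop
    (tendsto_norm_cobounded_atTop.comp tendsto_inv₀_nhdsNE_zero) _) hinv.norm

/-- If an automorphism of `ℂ*` tends to `0` at the origin, it has a simple zero there. -/
lemma exists_tendsto_div (h : IsPuncturedPlaneAut f g) (hf : Tendsto f (𝓝[≠] 0) (𝓝 0)) :
    ∃ c : ℂ, c ≠ 0 ∧ Tendsto (fun z => f z / z) (𝓝[≠] 0) (𝓝 c) := by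
  have hdf := (differentiable_update_of_tendsto h.differentiableOn hf 0).hasDerivAt
  set f₀ := Function.update f 0 0 with hf₀
  have hdg := (differentiable_update_of_tendsto h.differentiableOn_symm
    (h.symm_tendsto_zero hf) (f₀ 0)).hasDerivAt
  have hid : Function.update g 0 0 ∘ f₀ = id := by
    ext z
    rcases eq_or_ne z 0 with rfl | hz
    · simp [hf₀]
    · simp [hf₀, Function.update_of_ne hz, Function.update_of_ne (h.map_ne_zero z hz),
        h.left_inv z hz]
  have hcomp := hdg.comp 0 hdf
  rw [hid] at hcomp
  refine ⟨deriv f₀ 0, right_ne_zero_of_mul_eq_one (hcomp.unique (hasDerivAt_id 0)), ?_⟩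
  refine (hasDerivAt_iff_tendsto_slope.1 hdf).congr' ?_
  filter_upwards [self_mem_nhdsWithin] with z hz
  simp [slope_def_field, hf₀, Function.update_of_ne hz]

/-- An automorphism of `ℂ*` that tends to `0` at the origin is linear. -/
lemma eq_mul_of_tendsto_zero (h : IsPuncturedPlaneAut f g) (hf : Tendsto f (𝓝[≠] 0) (𝓝 0))
    {z : ℂ} (hz : z ≠ 0) : f z = f 1 * z := by
  rcases h.comp_inv.tendsto_zero_or_inv_tendsto_zero with hinf | hinf
  · exact absurd (eq_const_of_tendsto_zero_of_tendsto_inv h.differentiableOn hf hinf hz)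
      (h.map_ne_zero z hz)
  · obtain ⟨c, -, hc⟩ := h.exists_tendsto_div hf
    obtain ⟨d, hd, hlim⟩ := h.comp_inv.inv_comp.exists_tendsto_div hinf
    have hinv : Tendsto (fun w => f w⁻¹ / w⁻¹) (𝓝[≠] 0) (𝓝 d⁻¹) := by
      refine (hlim.inv₀ hd).congr fun w => ?_
      simp [div_eq_mul_inv, mul_comm]
    have hdiff : DifferentiableOn ℂ (fun w => f w / w) {w | w ≠ 0} :=
      h.differentiableOn.div differentiableOn_id fun _ hw => hw
    have hz' := eq_const_of_tendsto_zero_of_tendsto_inv hdiff hc hinv hz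
    have h1 := eq_const_of_tendsto_zero_of_tendsto_inv hdiff hc hinv one_ne_zero
    rw [div_one] at h1
    rw [h1, ← hz', div_mul_cancel₀ _ hz]

/-- The automorphisms of `ℂ*` are the maps `z ↦ c z` and `z ↦ c / z`. -/
lemma eq_mul_or_eq_mul_inv (h : IsPuncturedPlaneAut f g) :
    (∀ z, z ≠ 0 → f z = f 1 * z) ∨ (∀ z, z ≠ 0 → f z = f 1 * z⁻¹) := by
  rcases h.tendsto_zero_or_inv_tendsto_zero with hf | hf
  · exact Or.inl fun z hz => h.eq_mul_of_tendsto_zero hf hz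
  · refine Or.inr fun z hz => ?_
    have := h.inv_comp.eq_mul_of_tendsto_zero hf hz
    rw [← inv_inv (f z), this, mul_inv, inv_inv]

end IsPuncturedPlaneAut

section Product

variable {𝒟 : Set ℂ} {F G : ℂ × ℂ → ℂ × ℂ}

lemma differentiableOn_slice_right (hF : DifferentiableOn ℂ F (𝒟 ×ˢ {z : ℂ | z ≠ 0})) {l : ℂ}
    (hl : l ∈ 𝒟) : DifferentiableOn ℂ (fun z => F (l, z)) {z | z ≠ 0} :=
  hF.comp ((differentiableOn_const l).prodMk differentiableOn_id) fun _ hz => ⟨hl, hz⟩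

lemma differentiableOn_slice_left (hF : DifferentiableOn ℂ F (𝒟 ×ˢ {z : ℂ | z ≠ 0})) {z : ℂ}
    (hz : z ≠ 0) : DifferentiableOn ℂ (fun l => F (l, z)) 𝒟 :=
  hF.comp (differentiableOn_id.prodMk (differentiableOn_const z)) fun _ hl => ⟨hl, hz⟩

/-- Over a bounded base, the first component of a self-map of `𝒟 × ℂ*` depends only on the first
variable. -/
lemma fst_apply_eq (hbdd : Bornology.IsBounded 𝒟)
    (hF : DifferentiableOn ℂ F (𝒟 ×ˢ {z : ℂ | z ≠ 0}))
    (hmaps : MapsTo F (𝒟 ×ˢ {z : ℂ | z ≠ 0}) (𝒟 ×ˢ {z : ℂ | z ≠ 0})) {l z : ℂ} (hl : l ∈ 𝒟)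
    (hz : z ≠ 0) : (F (l, z)).1 = (F (l, 1)).1 := by
  refine apply_eq_apply_one_of_isBounded (f := fun z => (F (l, z)).1)
    (differentiableOn_slice_right hF hl).fst (hbdd.subset ?_) hz
  rintro _ ⟨w, hw, rfl⟩
  exact (hmaps (mk_mem_prod hl hw)).1

/-- A continuous family of maps `z ↦ c z^{±1}` over a connected base has constant exponent. -/
lemma exists_exponent (hconn : IsPreconnected 𝒟) {f : ℂ → ℂ → ℂ}
    (hcont : ∀ z, z ≠ 0 → ContinuousOn (fun l => f l z) 𝒟)
    (hne : ∀ l ∈ 𝒟, f l 1 ≠ 0)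
    (hf : ∀ l ∈ 𝒟, (∀ z, z ≠ 0 → f l z = f l 1 * z) ∨ (∀ z, z ≠ 0 → f l z = f l 1 * z⁻¹)) :
    ∃ ε : ℤ, (ε = 1 ∨ ε = -1) ∧ ∀ l ∈ 𝒟, ∀ z, z ≠ 0 → f l z = f l 1 * z ^ ε := by
  have hmul : ∀ l ∈ 𝒟, (∀ z, z ≠ 0 → f l z = f l 1 * z) → f l 2 / f l 1 = 2 := fun l hl h => by
    rw [h 2 two_ne_zero, mul_div_cancel_left₀ _ (hne l hl)]
  have hinv : ∀ l ∈ 𝒟, (∀ z, z ≠ 0 → f l z = f l 1 * z⁻¹) → f l 2 / f l 1 = 2⁻¹ :=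
    fun l hl h => by rw [h 2 two_ne_zero, mul_div_cancel_left₀ _ (hne l hl)]
  have hdisc : IsDiscrete ({2, 2⁻¹} : Set ℂ) := (Set.toFinite _).isDiscrete
  have hmaps : MapsTo (fun l => f l 2 / f l 1) 𝒟 {2, 2⁻¹} := fun l hl =>
    (hf l hl).imp (hmul l hl) (hinv l hl)
  obtain ⟨q, hq, hconst⟩ := hconn.eqOn_const_of_mapsTo hdisc
    ((hcont 2 two_ne_zero).div (hcont 1 one_ne_zero) hne) hmaps (by simp)
  have hneq : (2 : ℂ) ≠ 2⁻¹ := by norm_num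
  rcases hq with rfl | rfl
  · refine ⟨1, Or.inl rfl, fun l hl z hz => ?_⟩
    rcases hf l hl with h | h
    · simpa using h z hz
    · exact absurd ((hconst hl).symm.trans (hinv l hl h)) hneq
  · refine ⟨-1, Or.inr rfl, fun l hl z hz => ?_⟩
    rcases hf l hl with h | h
    · exact absurd ((hmul l hl h).symm.trans (hconst hl)) hneq
    · simpa using h z hz

lemma mapsTo_of_inverse {α : Type*} {s : Set α} {f g : α → α} (hf : SurjOn f s s)
    (hgf : ∀ z ∈ s, g (f z) = z) : MapsTo g s s := by
  intro w hw
  obtain ⟨z, hz, rfl⟩ := hf hw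
  rwa [hgf z hz]

lemma isAutomorphismOn_of_eq {a b : ℂ → ℂ} (ha : IsAutomorphismOn1 𝒟 a)
    (hb : DifferentiableOn ℂ b 𝒟) (hb0 : ∀ l ∈ 𝒟, b l ≠ 0) {ε : ℤ} (hε : ε = 1 ∨ ε = -1)
    (hF : ∀ z ∈ 𝒟 ×ˢ {z : ℂ | z ≠ 0}, F z = (a z.1, b z.1 * z.2 ^ ε)) :
    IsAutomorphismOn (𝒟 ×ˢ {z : ℂ | z ≠ 0}) F := by
  obtain ⟨had, habij, g, hg, hga, hag⟩ := ha
  have hgmaps := mapsTo_of_inverse habij.surjOn hga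
  have hεε : ∀ z : ℂ, (z ^ ε) ^ ε = z := by rcases hε with rfl | rfl <;> simp
  have hfst : MapsTo Prod.fst (𝒟 ×ˢ {z : ℂ | z ≠ 0}) 𝒟 := fun _ hz => hz.1
  have hgfst : MapsTo (fun z : ℂ × ℂ => g z.1) (𝒟 ×ˢ {z : ℂ | z ≠ 0}) 𝒟 :=
    fun _ hz => hgmaps hz.1
  have hgd : DifferentiableOn ℂ (fun z : ℂ × ℂ => g z.1) (𝒟 ×ˢ {z : ℂ | z ≠ 0}) :=
    hg.comp differentiableOn_fst hfst
  have hdiff : DifferentiableOn ℂ (fun z : ℂ × ℂ => (a z.1, b z.1 * z.2 ^ ε))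
      (𝒟 ×ˢ {z : ℂ | z ≠ 0}) :=
    (had.comp differentiableOn_fst hfst).prodMk ((hb.comp differentiableOn_fst hfst).mul
      (differentiableOn_snd.zpow (Or.inl fun _ hz => hz.2)))
  have hmaps : MapsTo F (𝒟 ×ˢ {z : ℂ | z ≠ 0}) (𝒟 ×ˢ {z : ℂ | z ≠ 0}) := fun z hz => by
    rw [hF z hz]
    exact ⟨habij.mapsTo hz.1, mul_ne_zero (hb0 _ hz.1) (zpow_ne_zero _ hz.2)⟩
  set G : ℂ × ℂ → ℂ × ℂ := fun z => (g z.1, (z.2 / b (g z.1)) ^ ε) with hG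
  have hGmaps : MapsTo G (𝒟 ×ˢ {z : ℂ | z ≠ 0}) (𝒟 ×ˢ {z : ℂ | z ≠ 0}) := fun z hz =>
    ⟨hgmaps hz.1, zpow_ne_zero _ (div_ne_zero hz.2 (hb0 _ (hgmaps hz.1)))⟩
  have hquot : DifferentiableOn ℂ (fun z : ℂ × ℂ => z.2 / b (g z.1)) (𝒟 ×ˢ {z : ℂ | z ≠ 0}) := by
    simp only [div_eq_mul_inv]
    exact differentiableOn_snd.mul ((hb.inv hb0).comp hgd hgfst)
  have hGd : DifferentiableOn ℂ G (𝒟 ×ˢ {z : ℂ | z ≠ 0}) :=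
    hgd.prodMk (hquot.zpow (Or.inl fun _ hz => div_ne_zero hz.2 (hb0 _ (hgmaps hz.1))))
  have hGF : ∀ z ∈ 𝒟 ×ˢ {z : ℂ | z ≠ 0}, G (F z) = z := fun z hz => by
    rw [hF z hz]
    simp only [hG, hga z.1 hz.1, mul_div_cancel_left₀ _ (hb0 z.1 hz.1), hεε]
  have hFG : ∀ z ∈ 𝒟 ×ˢ {z : ℂ | z ≠ 0}, F (G z) = z := fun z hz => by
    rw [hF _ (hGmaps hz)]
    simp only [hG, hag z.1 hz.1, hεε, mul_div_cancel₀ _ (hb0 _ (hgmaps hz.1))]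
  exact ⟨hdiff.congr hF, InvOn.bijOn ⟨hGF, hFG⟩ hmaps hGmaps, G, hGd, hGF, hFG⟩

lemma isAutomorphismOn1_fst (hbdd : Bornology.IsBounded 𝒟)
    (hF : DifferentiableOn ℂ F (𝒟 ×ˢ {z : ℂ | z ≠ 0}))
    (hG : DifferentiableOn ℂ G (𝒟 ×ˢ {z : ℂ | z ≠ 0}))
    (hFmaps : MapsTo F (𝒟 ×ˢ {z : ℂ | z ≠ 0}) (𝒟 ×ˢ {z : ℂ | z ≠ 0}))
    (hGmaps : MapsTo G (𝒟 ×ˢ {z : ℂ | z ≠ 0}) (𝒟 ×ˢ {z : ℂ | z ≠ 0}))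
    (hGF : ∀ z ∈ 𝒟 ×ˢ {z : ℂ | z ≠ 0}, G (F z) = z)
    (hFG : ∀ z ∈ 𝒟 ×ˢ {z : ℂ | z ≠ 0}, F (G z) = z) :
    IsAutomorphismOn1 𝒟 (fun l => (F (l, 1)).1) := by
  have hmem : ∀ l ∈ 𝒟, (l, (1 : ℂ)) ∈ 𝒟 ×ˢ {z : ℂ | z ≠ 0} := fun l hl => ⟨hl, one_ne_zero⟩
  have hga : ∀ l ∈ 𝒟, (G ((F (l, 1)).1, 1)).1 = l := fun l hl => by
    have h := hFmaps (hmem l hl)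
    rw [← fst_apply_eq hbdd hG hGmaps h.1 h.2, Prod.mk.eta, hGF _ (hmem l hl)]
  have hag : ∀ l ∈ 𝒟, (F ((G (l, 1)).1, 1)).1 = l := fun l hl => by
    have h := hGmaps (hmem l hl)
    rw [← fst_apply_eq hbdd hF hFmaps h.1 h.2, Prod.mk.eta, hFG _ (hmem l hl)]
  exact ⟨(differentiableOn_slice_left hF one_ne_zero).fst,
    InvOn.bijOn (f' := fun l => (G (l, 1)).1) ⟨hga, hag⟩ (fun l hl => (hFmaps (hmem l hl)).1)
      (fun l hl => (hGmaps (hmem l hl)).1),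
    fun l => (G (l, 1)).1, (differentiableOn_slice_left hG one_ne_zero).fst, hga, hag⟩

lemma isPuncturedPlaneAut_snd (hbdd : Bornology.IsBounded 𝒟)
    (hF : DifferentiableOn ℂ F (𝒟 ×ˢ {z : ℂ | z ≠ 0}))
    (hG : DifferentiableOn ℂ G (𝒟 ×ˢ {z : ℂ | z ≠ 0}))
    (hFmaps : MapsTo F (𝒟 ×ˢ {z : ℂ | z ≠ 0}) (𝒟 ×ˢ {z : ℂ | z ≠ 0}))
    (hGmaps : MapsTo G (𝒟 ×ˢ {z : ℂ | z ≠ 0}) (𝒟 ×ˢ {z : ℂ | z ≠ 0}))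
    (hGF : ∀ z ∈ 𝒟 ×ˢ {z : ℂ | z ≠ 0}, G (F z) = z)
    (hFG : ∀ z ∈ 𝒟 ×ˢ {z : ℂ | z ≠ 0}, F (G z) = z) {l : ℂ} (hl : l ∈ 𝒟) :
    IsPuncturedPlaneAut (fun z => (F (l, z)).2) (fun z => (G ((F (l, 1)).1, z)).2) := by
  have hm : (F (l, 1)).1 ∈ 𝒟 := (hFmaps (mk_mem_prod hl (one_ne_zero (α := ℂ)))).1
  have hFz : ∀ z, z ≠ 0 → ((F (l, 1)).1, (F (l, z)).2) = F (l, z) := fun z hz => by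
    rw [← fst_apply_eq hbdd hF hFmaps hl hz]
  have hbase : (G ((F (l, 1)).1, 1)).1 = l := by
    have h := hFmaps (mk_mem_prod hl (one_ne_zero (α := ℂ)))
    rw [← fst_apply_eq hbdd hG hGmaps h.1 h.2, Prod.mk.eta, hGF _ (mk_mem_prod hl (one_ne_zero (α := ℂ)))]
  have hGz : ∀ z, z ≠ 0 → (l, (G ((F (l, 1)).1, z)).2) = G ((F (l, 1)).1, z) := fun z hz => by
    nth_rewrite 1 [← hbase]
    rw [← fst_apply_eq hbdd hG hGmaps hm hz]
  exact
    { differentiableOn := (differentiableOn_slice_right hF hl).snd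
      differentiableOn_symm := (differentiableOn_slice_right hG hm).snd
      map_ne_zero := fun z hz => (hFmaps (mk_mem_prod hl hz)).2
      symm_ne_zero := fun z hz => (hGmaps (mk_mem_prod hm hz)).2
      left_inv := fun z hz => by rw [hFz z hz, hGF _ (mk_mem_prod hl hz)]
      right_inv := fun z hz => by rw [hGz z hz, hFG _ (mk_mem_prod hm hz)] }

end Product

/-- For a bounded domain `𝒟 ⊆ ℂ`, the automorphisms of `𝒟 × ℂ*` are exactly
the maps `(λ, z) ↦ (a(λ), b(λ) z^ε)` with `a ∈ Aut(𝒟)`, `b : 𝒟 → ℂ*`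
holomorphic, and `ε = ±1`. -/
theorem aut_bounded_times_Cstar
    (𝒟 : Set ℂ) (hopen : IsOpen 𝒟) (hconn : IsConnected 𝒟)
    (hbdd : Bornology.IsBounded 𝒟) (F : ℂ × ℂ → ℂ × ℂ) :
    IsAutomorphismOn (𝒟 ×ˢ {z : ℂ | z ≠ 0}) F ↔
      ∃ a : ℂ → ℂ, IsAutomorphismOn1 𝒟 a ∧
        ∃ b : ℂ → ℂ, DifferentiableOn ℂ b 𝒟 ∧ (∀ l ∈ 𝒟, b l ≠ 0) ∧
          ∃ ε : ℤ, (ε = 1 ∨ ε = -1) ∧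
            ∀ z ∈ 𝒟 ×ˢ {z : ℂ | z ≠ 0}, F z = (a z.1, b z.1 * z.2 ^ ε) := by
  refine ⟨?_, fun ⟨a, ha, b, hb, hb0, ε, hε, hF⟩ => isAutomorphismOn_of_eq ha hb hb0 hε hF⟩
  rintro ⟨hF, hbij, G, hG, hGF, hFG⟩
  have hGmaps := mapsTo_of_inverse hbij.surjOn hGF
  have hne : ∀ l ∈ 𝒟, (F (l, 1)).2 ≠ 0 := fun l hl =>
    (hbij.mapsTo (mk_mem_prod hl (one_ne_zero (α := ℂ)))).2
  obtain ⟨ε, hε, hform⟩ := exists_exponent hconn.isPreconnected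
    (f := fun l z => (F (l, z)).2)
    (fun z hz => (differentiableOn_slice_left hF hz).snd.continuousOn) hne
    (fun l hl => (isPuncturedPlaneAut_snd hbdd hF hG hbij.mapsTo hGmaps hGF hFG
      hl).eq_mul_or_eq_mul_inv)
  refine ⟨fun l => (F (l, 1)).1, isAutomorphismOn1_fst hbdd hF hG hbij.mapsTo hGmaps hGF hFG,
    fun l => (F (l, 1)).2, (differentiableOn_slice_left hF one_ne_zero).snd, hne, ε, hε, ?_⟩
  rintro ⟨l, z⟩ ⟨hl, hz⟩
  exact Prod.ext (fst_apply_eq hbdd hF hbij.mapsTo hl hz) (hform l hl z hz)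
end
end

section
/- Let p, q, n ∈ ℤ with n ≥ 1, q ≥ 1, and q·n² not a perfect square, and let α = (p + σ√q)/n where σ ∈ {1, −1}. Let x, y be positive integers satisfying the Pell equation x² − n² q y² = 1, and set l₁ = n² y, k₁ = x − p n y, k₂ = y(q − p²), l₂ = x + p n y. Then: (i) k₁ l₂ − k₂ l₁ = 1; (ii) k₁ + l₁ α = x + σ n y √q > 0; (iii) α·(k₁ + l₁ α) = k₂ + l₂ α; (iv) k₁ + l₂ = 2x > 2. -/
open Real

noncomputable section

/-- Arithmetic of the Pell-equation construction: for `α = (p + σ√q)/n` and a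
positive solution `(x,y)` of `x² − n²q y² = 1`, the integers
`l₁ = n²y`, `k₁ = x − pny`, `k₂ = y(q − p²)`, `l₂ = x + pny` satisfy
`k₁l₂ − k₂l₁ = 1`, `k₁ + l₁α = x + σny√q > 0`, `α(k₁ + l₁α) = k₂ + l₂α`, and
`k₁ + l₂ = 2x > 2`. -/
theorem pell_construction
    (p q n x y : ℤ) (hn : 1 ≤ n) (hq : 1 ≤ q) (hsq : ¬ IsSquare (q * n ^ 2))
    (σ : ℝ) (hσ : σ = 1 ∨ σ = -1)
    (α : ℝ) (hα : α = ((p : ℝ) + σ * Real.sqrt (q : ℝ)) / (n : ℝ))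
    (hx : 0 < x) (hy : 0 < y) (hpell : x ^ 2 - n ^ 2 * q * y ^ 2 = 1)
    (k₁ k₂ l₁ l₂ : ℤ)
    (hl₁ : l₁ = n ^ 2 * y) (hk₁ : k₁ = x - p * n * y)
    (hk₂ : k₂ = y * (q - p ^ 2)) (hl₂ : l₂ = x + p * n * y) :
    k₁ * l₂ - k₂ * l₁ = 1 ∧
    ((k₁ : ℝ) + (l₁ : ℝ) * α = (x : ℝ) + σ * (n : ℝ) * (y : ℝ) * Real.sqrt (q : ℝ) ∧
      0 < (k₁ : ℝ) + (l₁ : ℝ) * α) ∧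
    α * ((k₁ : ℝ) + (l₁ : ℝ) * α) = (k₂ : ℝ) + (l₂ : ℝ) * α ∧
    (k₁ + l₂ = 2 * x ∧ 2 < k₁ + l₂) := by
  have hn' : (n : ℝ) ≠ 0 := by
    have : n ≠ 0 := by lia
    exact_mod_cast this
  have hs : Real.sqrt (q : ℝ) ^ 2 = q := Real.sq_sqrt (by exact_mod_cast (by lia : 0 ≤ q))
  have hσ2 : σ ^ 2 = 1 := by rcases hσ with rfl | rfl <;> norm_num
  have hxR : (0 : ℝ) < x := by exact_mod_cast hx
  have hpellR : (x : ℝ) ^ 2 - n ^ 2 * q * y ^ 2 = 1 := by exact_mod_cast hpell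
  have hnα : (n : ℝ) * α = p + σ * Real.sqrt (q : ℝ) := by
    rw [hα]
    field_simp
  subst hl₁ hk₁ hk₂ hl₂
  have hsum : ((x - p * n * y : ℤ) : ℝ) + ((n ^ 2 * y : ℤ) : ℝ) * α
      = (x : ℝ) + σ * n * y * Real.sqrt (q : ℝ) := by
    push_cast
    linear_combination (n : ℝ) * y * hnα
  refine ⟨by linear_combination hpell, ⟨hsum, ?_⟩, ?_, by ring, ?_⟩
  · rw [hsum]
    have hlt : (σ * n * y * Real.sqrt (q : ℝ)) ^ 2 < (x : ℝ) ^ 2 := by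
      have : (σ * n * y * Real.sqrt (q : ℝ)) ^ 2 = (n : ℝ) ^ 2 * q * y ^ 2 := by
        rw [mul_pow, mul_pow, mul_pow, hσ2, hs]
        ring
      linarith
    linarith [(abs_lt_of_sq_lt_sq' hlt hxR.le).1]
  · rw [hsum]
    apply mul_left_cancel₀ hn'
    push_cast
    linear_combination
      ((σ * n * y * Real.sqrt (q : ℝ)) - p * n * y) * hnα + n * y * σ ^ 2 * hs + n * y * q * hσ2
  · have : 0 < n ^ 2 * q * y ^ 2 := by positivity
    have : 1 < x := by nlinarith
    linarith
end
end

section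
/- Let D ⊆ ℂ × ℂ* be a Reinhardt domain with {0} × ℂ* ⊆ D and log D = {(t,s) ∈ ℝ² : t < ψ(s)}, where ψ : ℝ → ℝ is a concave function satisfying ψ(β + s) − ψ(s) = α + k·s for all s ∈ ℝ, for some α, β ∈ ℝ with β ≠ 0 and some nonzero integer k. Then the map Φ(z₁,z₂) = (e^{α} z₁ z₂^{k}, e^{β} z₂) is an automorphism of D, and Aut(D) is not compact. -/
open Complex Set

noncomputable section

/-- A Reinhardt domain in `ℂ²`. -/
def IsReinhardt (D : Set (ℂ × ℂ)) : Prop :=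
  IsOpen D ∧ IsConnected D ∧
    ∀ z ∈ D, ∀ θ₁ θ₂ : ℝ,
      (Complex.exp (θ₁ * Complex.I) * z.1, Complex.exp (θ₂ * Complex.I) * z.2) ∈ D

/-- The logarithmic image of a Reinhardt domain. -/
def logImage (D : Set (ℂ × ℂ)) : Set (ℝ × ℝ) :=
  {x | ((Real.exp x.1 : ℂ), (Real.exp x.2 : ℂ)) ∈ D}

/-- `Aut(D)` as a set of continuous maps `D → ℂ²` (with the compact-open
topology on `C(D, ℂ × ℂ)`). -/
def AutSet (D : Set (ℂ × ℂ)) : Set C(D, ℂ × ℂ) :=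
  {f | ∃ F : ℂ × ℂ → ℂ × ℂ, IsAutomorphismOn D F ∧ ∀ z : D, f z = F z}

theorem IsAutomorphismOn.mapsTo_of_leftInv {D : Set (ℂ × ℂ)} {F G : ℂ × ℂ → ℂ × ℂ}
    (hF : Set.BijOn F D D) (hGF : ∀ z ∈ D, G (F z) = z) : Set.MapsTo G D D := by
  intro z hz
  obtain ⟨w, hw, rfl⟩ := hF.surjOn hz
  rwa [hGF w hw]

theorem IsAutomorphismOn.id (D : Set (ℂ × ℂ)) : IsAutomorphismOn D (fun z => z) :=
  ⟨differentiableOn_id, Set.bijOn_id D, fun z => z, differentiableOn_id,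
    fun _ _ => rfl, fun _ _ => rfl⟩

theorem IsAutomorphismOn.comp {D : Set (ℂ × ℂ)} {F₁ F₂ : ℂ × ℂ → ℂ × ℂ}
    (h₁ : IsAutomorphismOn D F₁) (h₂ : IsAutomorphismOn D F₂) :
    IsAutomorphismOn D (F₁ ∘ F₂) := by
  obtain ⟨d₁, b₁, G₁, e₁, l₁, r₁⟩ := h₁
  obtain ⟨d₂, b₂, G₂, e₂, l₂, r₂⟩ := h₂
  have m₁ := mapsTo_of_leftInv b₁ l₁
  refine ⟨d₁.comp d₂ b₂.mapsTo, b₁.comp b₂, G₂ ∘ G₁, e₂.comp e₁ m₁, fun z hz => ?_, fun z hz => ?_⟩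
  · simp [l₁ _ (b₂.mapsTo hz), l₂ z hz]
  · simp [r₂ _ (m₁ hz), r₁ z hz]

/-- Two mutually inverse holomorphic self-maps of `D` are automorphisms. -/
theorem IsAutomorphismOn.of_inverse {D : Set (ℂ × ℂ)} {F G : ℂ × ℂ → ℂ × ℂ}
    (hF : DifferentiableOn ℂ F D) (hG : DifferentiableOn ℂ G D)
    (mF : Set.MapsTo F D D) (mG : Set.MapsTo G D D)
    (hl : ∀ z ∈ D, G (F z) = z) (hr : ∀ z ∈ D, F (G z) = z) : IsAutomorphismOn D F :=
  ⟨hF, Set.InvOn.bijOn ⟨hl, hr⟩ mF mG, G, hG, hl, hr⟩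

theorem IsReinhardt.norm_mem_iff {D : Set (ℂ × ℂ)} (hR : IsReinhardt D) (z : ℂ × ℂ) :
    ((‖z.1‖ : ℂ), (‖z.2‖ : ℂ)) ∈ D ↔ z ∈ D := by
  constructor
  · intro h
    have := hR.2.2 _ h z.1.arg z.2.arg
    simp only [mul_comm (Complex.exp _), Complex.norm_mul_exp_arg_mul_I] at this
    exact this
  · intro h
    have key : ∀ w : ℂ, Complex.exp ((-w.arg : ℝ) * Complex.I) * w = ‖w‖ := by
      intro w
      conv_lhs => rw [← Complex.norm_mul_exp_arg_mul_I w]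
      rw [mul_left_comm, Complex.norm_mul_exp_arg_mul_I, ← Complex.exp_add]
      simp
    have := hR.2.2 _ h (-z.1.arg) (-z.2.arg)
    rwa [key, key] at this

/-- Membership in `D` read off from the logarithmic image. -/
theorem IsReinhardt.mem_iff_log_lt {D : Set (ℂ × ℂ)} (hR : IsReinhardt D)
    (hsub : D ⊆ {z : ℂ × ℂ | z.2 ≠ 0}) (haxis : {z : ℂ × ℂ | z.1 = 0 ∧ z.2 ≠ 0} ⊆ D)
    {ψ : ℝ → ℝ} (hlog : logImage D = {x : ℝ × ℝ | x.1 < ψ x.2}) (z : ℂ × ℂ) :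
    z ∈ D ↔ z.2 ≠ 0 ∧ (z.1 ≠ 0 → Real.log ‖z.1‖ < ψ (Real.log ‖z.2‖)) := by
  by_cases h2 : z.2 = 0
  · exact ⟨fun h => absurd h2 (hsub h), fun h => absurd h2 h.1⟩
  by_cases h1 : z.1 = 0
  · exact ⟨fun _ => ⟨h2, fun h => absurd h1 h⟩, fun _ => haxis ⟨h1, h2⟩⟩
  have h := Set.ext_iff.1 hlog (Real.log ‖z.1‖, Real.log ‖z.2‖)
  simp only [logImage, Set.mem_ofPred_eq, Real.exp_log (norm_pos_iff.2 h1),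
    Real.exp_log (norm_pos_iff.2 h2), hR.norm_mem_iff z] at h
  simp [h, h1, h2]

theorem continuous_log_norm_snd_eval {D : Set (ℂ × ℂ)} (p : D) {S : Set C(D, ℂ × ℂ)}
    (hS : ∀ f ∈ S, (f p).2 ≠ 0) : ContinuousOn (fun f : C(D, ℂ × ℂ) => Real.log ‖(f p).2‖) S :=
  ContinuousOn.log (continuous_snd.comp (continuous_eval_const p)).norm.continuousOn
    fun f hf => norm_ne_zero_iff.2 (hS f hf)

/-- If `D ⊆ ℂ × ℂ*` is a Reinhardt domain containing `{0} × ℂ*` with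
`log D = {(t,s) : t < ψ(s)}` for a concave `ψ` satisfying
`ψ(β + s) − ψ(s) = α + k s` (`β ≠ 0`, `k ∈ ℤ` nonzero), then
`Φ(z₁,z₂) = (e^α z₁ z₂^k, e^β z₂)` is an automorphism of `D` and `Aut(D)`
is not compact. -/
theorem noncompact_aut_of_psi
    (D : Set (ℂ × ℂ)) (hR : IsReinhardt D) (hsub : D ⊆ {z : ℂ × ℂ | z.2 ≠ 0})
    (haxis : {z : ℂ × ℂ | z.1 = 0 ∧ z.2 ≠ 0} ⊆ D)
    (ψ : ℝ → ℝ) (hconc : ConcaveOn ℝ Set.univ ψ)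
    (hlog : logImage D = {x : ℝ × ℝ | x.1 < ψ x.2})
    (α β : ℝ) (hβ : β ≠ 0) (k : ℤ) (hk : k ≠ 0)
    (hfe : ∀ s : ℝ, ψ (β + s) - ψ s = α + (k : ℝ) * s) :
    IsAutomorphismOn D
      (fun z : ℂ × ℂ => ((Real.exp α : ℂ) * z.1 * z.2 ^ k, (Real.exp β : ℂ) * z.2)) ∧
    ¬ IsCompact (AutSet D) := by
  have hmem := hR.mem_iff_log_lt hsub haxis hlog
  have hΦ : IsAutomorphismOn D
      (fun z : ℂ × ℂ => ((Real.exp α : ℂ) * z.1 * z.2 ^ k, (Real.exp β : ℂ) * z.2)) := by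
    have ea : (Real.exp α : ℂ) ≠ 0 := by exact_mod_cast (Real.exp_pos α).ne'
    have eb : (Real.exp β : ℂ) ≠ 0 := by exact_mod_cast (Real.exp_pos β).ne'
    have hiff : ∀ z : ℂ × ℂ,
        ((Real.exp α : ℂ) * z.1 * z.2 ^ k, (Real.exp β : ℂ) * z.2) ∈ D ↔ z ∈ D := by
      intro z
      rw [hmem, hmem]
      by_cases h2 : z.2 = 0
      · simp [h2]
      by_cases h1 : z.1 = 0
      · simp [h1, h2]
      have n1 := norm_ne_zero_iff.2 h1
      have n2 := norm_ne_zero_iff.2 h2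
      have l2 : Real.log ‖(Real.exp β : ℂ) * z.2‖ = β + Real.log ‖z.2‖ := by
        rw [norm_mul, Complex.norm_real, Real.norm_of_nonneg (Real.exp_pos β).le,
          Real.log_mul (Real.exp_pos β).ne' n2, Real.log_exp]
      have l1 : Real.log ‖(Real.exp α : ℂ) * z.1 * z.2 ^ k‖ =
          α + Real.log ‖z.1‖ + k * Real.log ‖z.2‖ := by
        rw [norm_mul, norm_mul, norm_zpow, Complex.norm_real,
          Real.norm_of_nonneg (Real.exp_pos α).le,
          Real.log_mul (mul_ne_zero (Real.exp_pos α).ne' n1) (zpow_ne_zero k n2),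
          Real.log_mul (Real.exp_pos α).ne' n1, Real.log_exp, Real.log_zpow]
      have h := hfe (Real.log ‖z.2‖)
      have e : Real.log ‖(Real.exp α : ℂ) * z.1 * z.2 ^ k‖ <
          ψ (Real.log ‖(Real.exp β : ℂ) * z.2‖) ↔ Real.log ‖z.1‖ < ψ (Real.log ‖z.2‖) := by
        rw [l1, l2]
        constructor <;> intro <;> linarith
      simp only [ne_eq, mul_ne_zero eb h2, mul_ne_zero (mul_ne_zero ea h1) (zpow_ne_zero k h2),
        h1, h2, e]
    have hr : ∀ z ∈ D, ((Real.exp α : ℂ) * ((Real.exp α : ℂ)⁻¹ * z.1 *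
        ((Real.exp β : ℂ)⁻¹ * z.2) ^ (-k)) * ((Real.exp β : ℂ)⁻¹ * z.2) ^ k,
        (Real.exp β : ℂ) * ((Real.exp β : ℂ)⁻¹ * z.2)) = z := by
      intro z hz
      have h := zpow_ne_zero k (mul_ne_zero (inv_ne_zero eb) (hsub hz))
      ext1
      · simp only [zpow_neg]
        rw [mul_assoc, mul_assoc, mul_assoc, inv_mul_cancel₀ h, mul_one, mul_inv_cancel_left₀ ea]
      · exact mul_inv_cancel_left₀ eb _
    refine IsAutomorphismOn.of_inverse (G := fun z => ((Real.exp α : ℂ)⁻¹ * z.1 *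
      ((Real.exp β : ℂ)⁻¹ * z.2) ^ (-k), (Real.exp β : ℂ)⁻¹ * z.2)) ?_ ?_
      (fun z hz => (hiff z).2 hz) (fun z hz => (hiff _).1 ((hr z hz).symm ▸ hz))
      (fun z hz => ?_) hr
    · refine DifferentiableOn.prodMk (DifferentiableOn.mul (by fun_prop) ?_) (by fun_prop)
      exact differentiableOn_snd.zpow (Or.inl fun z hz => hsub hz)
    · refine DifferentiableOn.prodMk (DifferentiableOn.mul (by fun_prop) ?_) (by fun_prop)
      exact DifferentiableOn.zpow (by fun_prop)
        (Or.inl fun z hz => mul_ne_zero (inv_ne_zero eb) (hsub hz))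
    · have h := zpow_ne_zero k (hsub hz)
      ext1
      · simp only [inv_mul_cancel_left₀ eb, zpow_neg]
        rw [mul_assoc, mul_assoc, mul_assoc, mul_inv_cancel₀ h, mul_one, inv_mul_cancel_left₀ ea]
      · exact inv_mul_cancel_left₀ eb _
  refine ⟨hΦ, fun hK => ?_⟩
  have hp : ((0 : ℂ), (1 : ℂ)) ∈ D := haxis ⟨rfl, one_ne_zero⟩
  have orbit : ∀ n : ℕ, ∃ F, IsAutomorphismOn D F ∧ F (0, 1) = (0, (Real.exp (n * β) : ℂ)) := by
    intro n
    induction n with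
    | zero => exact ⟨_, IsAutomorphismOn.id D, by simp⟩
    | succ n ih =>
      obtain ⟨F, hF, h⟩ := ih
      refine ⟨_, hΦ.comp hF, ?_⟩
      rw [Function.comp_apply, h, Nat.cast_succ, add_mul, one_mul, add_comm, Real.exp_add]
      simp
  have hcont := continuous_log_norm_snd_eval (⟨_, hp⟩ : D) (S := AutSet D) (by
    rintro f ⟨F, hF, h⟩
    rw [h]
    exact hsub (hF.2.1.mapsTo hp))
  obtain ⟨C, hC⟩ := hK.exists_bound_of_continuousOn hcont
  obtain ⟨n, hn⟩ := exists_nat_gt (C / |β|)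
  obtain ⟨F, hF, h⟩ := orbit n
  have hle : ‖Real.log ‖(F (0, 1)).2‖‖ ≤ C :=
    hC ⟨D.domRestrict F, hF.1.continuousOn.domRestrict⟩ ⟨F, hF, fun _ => rfl⟩
  rw [div_lt_iff₀ (abs_pos.2 hβ)] at hn
  simp only [h, Complex.norm_real, Real.norm_of_nonneg (Real.exp_pos _).le, Real.log_exp,
    Real.norm_eq_abs, abs_mul, Nat.abs_cast] at hle
  linarith
end
end
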